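/- arXiv:2411.00779 — 2 statements merged into one kernel-verified Lean document; each statement's English description precedes it below -/
import Mathlib

section
/- Let n ≥ 2, q > 1, let Ω ⊂ ℝⁿ be a convex body, and let u be a q-torsion function of Ω whose gradient is bounded on the interior of Ω. Then ∫_{int Ω} ‖∇u(y)‖^q dy = ∫_{Ω} u(y) dy (integrals with respect to Lebesgue measure). -/
open MeasureTheory Metric Filter
open scoped InnerProductSpace ENNReal Topology

/-- The support function of a set `K`: `h_K(x) = sup_{y ∈ K} ⟪x, y⟫`. -/
noncomputable def suppFn {n : ℕ} (K : Set (EuclideanSpace ℝ (Fin n)))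
    (x : EuclideanSpace ℝ (Fin n)) : ℝ :=
  sSup ((fun y => ⟪x, y⟫_ℝ) '' K)

/-- The radial function of a set `K`: `ρ_K(v) = max {c > 0 : c • v ∈ K}`. -/
noncomputable def radFn {n : ℕ} (K : Set (EuclideanSpace ℝ (Fin n)))
    (v : EuclideanSpace ℝ (Fin n)) : ℝ :=
  sSup {c : ℝ | 0 < c ∧ c • v ∈ K}


/-- `u` is a `q`-torsion function of the convex body `Ω`, with (continuous extension of the)
gradient `G`: `u` is continuous on `Ω`, vanishes on `∂Ω`, is positive on the interior,
has gradient `G` on the interior, `G` is continuous on `Ω`, and `Δ_q u = -1` weakly. -/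
structure IsQTorsion {n : ℕ} (q : ℝ) (Ω : Set (EuclideanSpace ℝ (Fin n)))
    (u : EuclideanSpace ℝ (Fin n) → ℝ)
    (G : EuclideanSpace ℝ (Fin n) → EuclideanSpace ℝ (Fin n)) : Prop where
  contOn : ContinuousOn u Ω
  zero_on_bdry : ∀ y ∈ frontier Ω, u y = 0
  pos_on_int : ∀ y ∈ interior Ω, 0 < u y
  grad_on_int : ∀ y ∈ interior Ω, HasGradientAt u (G y) y
  grad_cont : ContinuousOn G Ω
  weak_sol : ∀ φ : EuclideanSpace ℝ (Fin n) → ℝ, ContDiff ℝ (⊤ : ℕ∞) φ → HasCompactSupport φ →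
    tsupport φ ⊆ interior Ω →
    ∫ y in interior Ω, ‖G y‖ ^ (q - 2) * ⟪G y, gradient φ y⟫_ℝ = ∫ y in interior Ω, φ y

/-- The spherical Lebesgue measure `σ` on `S^{n-1}`: the `(n-1)`-dimensional Hausdorff
measure restricted to the unit sphere. -/
noncomputable def sphLeb (n : ℕ) : Measure (EuclideanSpace ℝ (Fin n)) :=
  (μH[(n : ℝ) - 1]).restrict (sphere (0 : EuclideanSpace ℝ (Fin n)) 1)

/-- The reverse radial Gauss image of `η ⊆ S^{n-1}` with respect to `Ω`:
`α*_Ω(η) = {v ∈ S^{n-1} : ∃ ξ ∈ η, ρ_Ω(v)⟪v,ξ⟫ = h_Ω(ξ)}`. -/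
def revRadGauss {n : ℕ} (Ω η : Set (EuclideanSpace ℝ (Fin n))) :
    Set (EuclideanSpace ℝ (Fin n)) :=
  {v | v ∈ sphere (0 : EuclideanSpace ℝ (Fin n)) 1 ∧
    ∃ ξ ∈ η, radFn Ω v * ⟪v, ξ⟫_ℝ = suppFn Ω ξ}

/-- The `p`-th dual `q`-torsional measure of `Ω` (with torsion gradient `G`) evaluated on `η`:
`Q̃_{q,n-p}(Ω,η) = ((q-1)/(n(q-1)+q)) ∫_{α*_Ω(η)} ρ_Ω(v)^p ‖∇u(ρ_Ω(v)v)‖^q dσ(v)`. -/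
noncomputable def dualTorsMeas {n : ℕ} (q p : ℝ) (Ω : Set (EuclideanSpace ℝ (Fin n)))
    (G : EuclideanSpace ℝ (Fin n) → EuclideanSpace ℝ (Fin n))
    (η : Set (EuclideanSpace ℝ (Fin n))) : ℝ :=
  ((q - 1) / (n * (q - 1) + q)) *
    ∫ v in revRadGauss Ω η, (radFn Ω v) ^ p * ‖G (radFn Ω v • v)‖ ^ q ∂(sphLeb n)

lemma aux_mollify {n : ℕ} (v : EuclideanSpace ℝ (Fin n) → ℝ) (hv : ContDiff ℝ 1 v)
    (hc : HasCompactSupport v) (U : Set (EuclideanSpace ℝ (Fin n))) (hU : IsOpen U)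
    (hs : tsupport v ⊆ U) (η : ℝ) (hη : 0 < η) :
    ∃ φ : EuclideanSpace ℝ (Fin n) → ℝ, ContDiff ℝ (⊤ : ℕ∞) φ ∧ HasCompactSupport φ ∧
      tsupport φ ⊆ U ∧ ∀ x, dist (φ x) (v x) ≤ η ∧
        dist (gradient φ x) (gradient v x) ≤ η := by
  have hdc : Continuous (fderiv ℝ v) := hv.continuous_fderiv one_ne_zero
  have hdcs : HasCompactSupport (fderiv ℝ v) := hc.fderiv ℝ
  obtain ⟨δ₁, hδ₁, h1⟩ := Metric.uniformContinuous_iff.1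
    (hc.uniformContinuous_of_continuous hv.continuous) η hη
  obtain ⟨δ₂, hδ₂, h2⟩ := Metric.uniformContinuous_iff.1
    (hdcs.uniformContinuous_of_continuous hdc) η hη
  obtain ⟨δ₃, hδ₃, h3⟩ := hc.isCompact.exists_cthickening_subset_open hU hs
  set δ := min δ₁ (min δ₂ δ₃) with hδdef
  have hδ : 0 < δ := lt_min hδ₁ (lt_min hδ₂ hδ₃)
  let B : ContDiffBump (0 : EuclideanSpace ℝ (Fin n)) := ⟨δ / 2, δ, by linarith, by linarith⟩
  have hBout : B.rOut = δ := rfl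
  let φ := MeasureTheory.convolution (B.normed volume) v (ContinuousLinearMap.lsmul ℝ ℝ) volume
  have hsub : tsupport φ ⊆ Metric.cthickening δ₃ (tsupport v) := by
    apply closure_minimal _ Metric.isClosed_cthickening
    intro x hx
    obtain ⟨a, ha, b, hb, rfl⟩ := Set.mem_add.1 (support_convolution_subset _ hx)
    rw [B.support_normed_eq, hBout, mem_ball_zero_iff] at ha
    apply Metric.mem_cthickening_of_dist_le _ b δ₃ _ (subset_tsupport _ hb)
    rw [dist_eq_norm, add_sub_cancel_right]
    exact ha.le.trans ((min_le_right _ _).trans (min_le_right _ _))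
  refine ⟨φ, ?_, ?_, hsub.trans h3, fun x => ⟨?_, ?_⟩⟩
  · exact B.hasCompactSupport_normed.contDiff_convolution_left _ B.contDiff_normed
      hv.continuous.locallyIntegrable
  · exact (hc.isCompact.cthickening (r := δ₃)).of_isClosed_subset (isClosed_tsupport _) hsub
  · apply B.dist_normed_convolution_le hv.continuous.aestronglyMeasurable
    intro y hy
    exact (h1 (lt_of_lt_of_le hy (min_le_left _ _))).le
  · have hd : HasFDerivAt φ _ x := hc.hasFDerivAt_convolution_right
      (ContinuousLinearMap.lsmul ℝ ℝ) (f := B.normed volume) (μ := volume)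
      (B.continuous_normed.locallyIntegrable) hv x
    have key : dist (fderiv ℝ φ x) (fderiv ℝ v x) ≤ η := by
      rw [hd.fderiv]
      have := B.dist_normed_convolution_le (μ := volume) (g := fderiv ℝ v) (x₀ := x) (ε := η)
        hdc.aestronglyMeasurable (fun y hy =>
          (h2 (lt_of_lt_of_le hy ((min_le_right _ _).trans (min_le_left _ _)))).le)
      exact this
    unfold gradient
    rwa [LinearIsometryEquiv.dist_map]

lemma aux_bound {E : Type*} [NormedAddCommGroup E] [InnerProductSpace ℝ E] (q M C : ℝ)
    (hq : 1 < q) (g w : E) (hg : ‖g‖ ≤ M) (hw : ‖w‖ ≤ C) :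
    ‖‖g‖ ^ (q - 2) * ⟪g, w⟫_ℝ‖ ≤ M ^ (q - 1) * C := by
  have hC : 0 ≤ C := (norm_nonneg _).trans hw
  have hM : 0 ≤ M := (norm_nonneg _).trans hg
  rcases eq_or_ne g 0 with rfl | h0
  · simp; positivity
  have hp : 0 < ‖g‖ := norm_pos_iff.2 h0
  rw [norm_mul, Real.norm_of_nonneg (by positivity)]
  calc ‖g‖ ^ (q - 2) * ‖⟪g, w⟫_ℝ‖ ≤ ‖g‖ ^ (q - 2) * (‖g‖ * ‖w‖) := by
        gcongr; exact norm_inner_le_norm _ _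
    _ = ‖g‖ ^ (q - 1) * ‖w‖ := by
        rw [← mul_assoc, ← Real.rpow_add_one hp.ne']; congr 2; ring
    _ ≤ M ^ (q - 1) * C := by
        gcongr

/-- The weak equation holds for `C¹` test functions. -/
lemma aux_weak {n : ℕ} (q : ℝ) (hq : 1 < q)
    (Ω : Set (EuclideanSpace ℝ (Fin n))) (hΩ_comp : IsCompact Ω)
    (u : EuclideanSpace ℝ (Fin n) → ℝ)
    (G : EuclideanSpace ℝ (Fin n) → EuclideanSpace ℝ (Fin n))
    (hu : IsQTorsion q Ω u G) (M : ℝ) (hM : ∀ y ∈ interior Ω, ‖G y‖ ≤ M)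
    (v : EuclideanSpace ℝ (Fin n) → ℝ) (hv : ContDiff ℝ 1 v)
    (hc : HasCompactSupport v) (hs : tsupport v ⊆ interior Ω) :
    ∫ y in interior Ω, ‖G y‖ ^ (q - 2) * ⟪G y, gradient v y⟫_ℝ = ∫ y in interior Ω, v y := by
  have hη : ∀ k : ℕ, (0 : ℝ) < 1 / ((k : ℝ) + 1) := fun k => Nat.one_div_pos_of_nat
  have hη1 : ∀ k : ℕ, 1 / ((k : ℝ) + 1) ≤ 1 := fun k => by
    rw [div_le_one (by positivity)]; linarith [Nat.cast_nonneg (α := ℝ) k]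
  choose φ h1 h2 h3 h4 using fun k : ℕ =>
    aux_mollify v hv hc (interior Ω) isOpen_interior hs _ (hη k)
  have hlim := tendsto_one_div_add_atTop_nhds_zero_nat (𝕜 := ℝ)
  have hfin : volume (interior Ω) ≠ ∞ :=
    ((measure_mono interior_subset).trans_lt hΩ_comp.measure_lt_top).ne
  have : IsFiniteMeasure (volume.restrict (interior Ω)) := ⟨by simpa using hfin.lt_top⟩
  have hGm : AEStronglyMeasurable G (volume.restrict (interior Ω)) :=
    (hu.grad_cont.mono interior_subset).aestronglyMeasurable isOpen_interior.measurableSet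
  have hgc : ∀ f : EuclideanSpace ℝ (Fin n) → ℝ, ContDiff ℝ 1 f → Continuous (gradient f) :=
    fun f hf => (InnerProductSpace.toDual ℝ _).symm.continuous.comp
      (hf.continuous_fderiv one_ne_zero)
  have hgcs : HasCompactSupport (gradient v) := (hc.fderiv ℝ).comp_left (map_zero _)
  obtain ⟨C, hC⟩ := hgcs.exists_bound_of_continuous (hgc v hv)
  obtain ⟨D, hD⟩ := hc.exists_bound_of_continuous hv.continuous
  have hφ1 : ∀ k, ContDiff ℝ 1 (φ k) := fun k => (h1 k).of_le (by exact_mod_cast le_top)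
  have t1 : Tendsto (fun k => ∫ y in interior Ω, φ k y) atTop (𝓝 (∫ y in interior Ω, v y)) := by
    refine tendsto_integral_of_dominated_convergence (fun _ => D + 1) 
      (fun k => (h1 k).continuous.aestronglyMeasurable) (integrable_const _)
      (fun k => ae_of_all _ fun x => ?_) (ae_of_all _ fun x => ?_)
    · have := (h4 k x).1
      rw [dist_eq_norm] at this
      have h5 := norm_le_norm_add_norm_sub' (φ k x) (v x)
      linarith [hD x, hη1 k]
    · exact tendsto_iff_dist_tendsto_zero.2
        (squeeze_zero (fun _ => dist_nonneg) (fun k => (h4 k x).1) hlim)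
  have t2 : Tendsto (fun k => ∫ y in interior Ω, ‖G y‖ ^ (q - 2) * ⟪G y, gradient (φ k) y⟫_ℝ) atTop
      (𝓝 (∫ y in interior Ω, ‖G y‖ ^ (q - 2) * ⟪G y, gradient v y⟫_ℝ)) := by
    refine tendsto_integral_of_dominated_convergence (fun _ => M ^ (q - 1) * (C + 1)) 
      (fun k => ?_) (integrable_const _)
      (fun k => ?_) (ae_of_all _ fun x => ?_)
    · exact (hGm.norm.aemeasurable.pow_const _).aestronglyMeasurable.mul
        (hGm.inner (hgc _ (hφ1 k)).aestronglyMeasurable)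
    · filter_upwards [ae_restrict_mem isOpen_interior.measurableSet] with x hx
      apply aux_bound q M _ hq _ _ (hM x hx)
      have := (h4 k x).2
      rw [dist_eq_norm] at this
      have h5 := norm_le_norm_add_norm_sub' (gradient (φ k) x) (gradient v x)
      linarith [hC x, hη1 k]
    · have : Tendsto (fun k => gradient (φ k) x) atTop (𝓝 (gradient v x)) :=
        tendsto_iff_dist_tendsto_zero.2
        (squeeze_zero (fun _ => dist_nonneg) (fun k => (h4 k x).2) hlim)
      exact (tendsto_const_nhds.inner this).const_mul _
  refine tendsto_nhds_unique t2 (t1.congr fun k => ?_)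
  exact (hu.weak_sol (φ k) (h1 k) (h2 k) (h3 k)).symm

/-- Cutoff derivative. -/
noncomputable def auxW (k : ℕ) (s : ℝ) : ℝ := max 0 (min 1 (((k : ℝ) + 1) * s - 1))

lemma auxW_cont (k : ℕ) : Continuous (auxW k) := by unfold auxW; fun_prop

lemma auxW_nonneg (k : ℕ) (s : ℝ) : 0 ≤ auxW k s := le_max_left _ _

lemma auxW_le (k : ℕ) (s : ℝ) : auxW k s ≤ 1 := max_le zero_le_one (min_le_left _ _)

lemma auxW_zero (k : ℕ) (s : ℝ) (h : s ≤ 1 / ((k : ℝ) + 1)) : auxW k s = 0 := by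
  rw [le_div_iff₀ (by positivity)] at h
  exact max_eq_left ((min_le_right _ _).trans (by linarith))

lemma auxW_tendsto (s : ℝ) (h : 0 < s) : Tendsto (fun k => auxW k s) atTop (𝓝 1) := by
  obtain ⟨N, hN⟩ := exists_nat_gt (2 / s)
  rw [div_lt_iff₀ h] at hN
  refine tendsto_const_nhds.congr' ?_
  filter_upwards [eventually_ge_atTop N] with k hk
  have : (N : ℝ) ≤ k := by exact_mod_cast hk
  unfold auxW
  rw [min_eq_left (by nlinarith), max_eq_right zero_le_one]

/-- Cutoff. -/
noncomputable def auxH (k : ℕ) (t : ℝ) : ℝ := ∫ s in (0 : ℝ)..t, auxW k s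

lemma auxH_deriv (k : ℕ) (t : ℝ) : HasDerivAt (auxH k) (auxW k t) t :=
  (auxW_cont k).integral_hasStrictDerivAt 0 t |>.hasDerivAt

lemma auxH_cont (k : ℕ) : Continuous (auxH k) :=
  continuous_iff_continuousAt.2 fun t => (auxH_deriv k t).continuousAt

lemma auxH_zero (k : ℕ) (t : ℝ) (h : t ≤ 1 / ((k : ℝ) + 1)) : auxH k t = 0 := by
  have h0 : (0 : ℝ) ≤ 1 / ((k : ℝ) + 1) := by positivity
  unfold auxH
  rw [intervalIntegral.integral_congr (g := fun _ => (0 : ℝ))]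
  · simp
  · intro s hs
    exact auxW_zero k s (hs.2.trans (max_le h0 h))

lemma auxH_bound (k : ℕ) (t : ℝ) : ‖auxH k t‖ ≤ ‖t‖ := by
  have := intervalIntegral.norm_integral_le_of_norm_le_const (a := 0) (b := t) (C := 1)
    (f := auxW k) (fun x _ => by
      rw [Real.norm_of_nonneg (auxW_nonneg k x)]; exact auxW_le k x)
  simpa [auxH] using this

lemma auxH_tendsto (t : ℝ) (h : 0 < t) : Tendsto (fun k => auxH k t) atTop (𝓝 t) := by
  have : Tendsto (fun k => auxH k t) atTop (𝓝 (∫ s in (0 : ℝ)..t, (1 : ℝ))) := by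
    refine intervalIntegral.tendsto_integral_filter_of_dominated_convergence (fun _ => 1)
      (Eventually.of_forall fun k => (auxW_cont k).aestronglyMeasurable)
      (Eventually.of_forall fun k => ae_of_all _ fun s _ => ?_) (by simp)
      (ae_of_all _ fun s hs => ?_)
    · rw [Real.norm_of_nonneg (auxW_nonneg k s)]; exact auxW_le k s
    · rw [Set.uIoc_of_le h.le] at hs
      exact auxW_tendsto s hs.1
  simpa using this

/-- The energy identity for the truncated function. -/
lemma aux_trunc {n : ℕ} (q : ℝ) (hq : 1 < q)
    (Ω : Set (EuclideanSpace ℝ (Fin n))) (hΩ_comp : IsCompact Ω)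
    (u : EuclideanSpace ℝ (Fin n) → ℝ)
    (G : EuclideanSpace ℝ (Fin n) → EuclideanSpace ℝ (Fin n))
    (hu : IsQTorsion q Ω u G) (M : ℝ) (hM : ∀ y ∈ interior Ω, ‖G y‖ ≤ M) (k : ℕ) :
    ∫ y in interior Ω, auxW k (u y) * ‖G y‖ ^ q = ∫ y in interior Ω, auxH k (u y) := by
  classical
  set ε : ℝ := 1 / ((k : ℝ) + 1) with hε
  have hε0 : 0 < ε := by positivity
  let K : Set (EuclideanSpace ℝ (Fin n)) := Ω ∩ u ⁻¹' Set.Ici ε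
  have hKc : IsClosed K := hu.contOn.preimage_isClosed_of_isClosed hΩ_comp.isClosed isClosed_Ici
  have hKcomp : IsCompact K := hΩ_comp.of_isClosed_subset hKc Set.inter_subset_left
  have hKi : K ⊆ interior Ω := by
    intro y hy
    by_contra hni
    have := hu.zero_on_bdry y ⟨subset_closure hy.1, hni⟩
    have h2 : ε ≤ u y := hy.2
    linarith
  let v : EuclideanSpace ℝ (Fin n) → ℝ := (interior Ω).indicator fun y => auxH k (u y)
  let V : EuclideanSpace ℝ (Fin n) → EuclideanSpace ℝ (Fin n) :=
    (interior Ω).indicator fun y => auxW k (u y) • G y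
  have hout : ∀ y, y ∉ K → v y = 0 ∧ V y = 0 := by
    intro y hy
    by_cases hyi : y ∈ interior Ω
    · have hlt : u y ≤ ε := by
        by_contra hlt
        exact hy ⟨interior_subset hyi, (not_le.1 hlt).le⟩
      simp only [v, V, Set.indicator_of_mem hyi]
      rw [auxH_zero k _ hlt, auxW_zero k _ hlt, zero_smul]
      exact ⟨rfl, rfl⟩
    · simp only [v, V, Set.indicator_of_notMem hyi]
      exact ⟨trivial, trivial⟩
  have hvs : tsupport v ⊆ K := by
    apply closure_minimal _ hKc
    intro y hy
    by_contra hn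
    exact hy (hout y hn).1
  have hvc : HasCompactSupport v := hKcomp.of_isClosed_subset (isClosed_tsupport _) hvs
  have hgrad : ∀ y, HasGradientAt v (V y) y := by
    intro y
    by_cases hy : y ∈ K
    · have hyi := hKi hy
      have h1 : HasGradientAt (fun z => auxH k (u z)) (auxW k (u y) • G y) y := by
        rw [hasGradientAt_iff_hasFDerivAt]
        have := (auxH_deriv k (u y)).comp_hasFDerivAt y (hu.grad_on_int y hyi).hasFDerivAt
        rw [map_smulₛₗ]
        exact this
      have h2 : v =ᶠ[𝓝 y] fun z => auxH k (u z) := by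
        filter_upwards [isOpen_interior.mem_nhds hyi] with z hz
        exact Set.indicator_of_mem hz _
      have h3 : V y = auxW k (u y) • G y := Set.indicator_of_mem hyi _
      rw [h3]
      exact h1.congr_of_eventuallyEq h2
    · rw [(hout y hy).2]
      have h2 : v =ᶠ[𝓝 y] fun z => 0 := by
        filter_upwards [hKc.isOpen_compl.mem_nhds hy] with z hz
        exact (hout z hz).1
      exact (hasGradientAt_const y (0 : ℝ)).congr_of_eventuallyEq h2
  have hVc : Continuous V := by
    rw [continuous_iff_continuousAt]
    intro y
    by_cases hy : y ∈ K
    · have hyi := hKi hy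
      have hn : Ω ∈ 𝓝 y := mem_interior_iff_mem_nhds.1 hyi
      have h1 : ContinuousAt (fun y => auxW k (u y) • G y) y :=
        ((auxW_cont k).continuousAt.comp (hu.contOn.continuousAt hn)).smul
          (hu.grad_cont.continuousAt hn)
      apply h1.congr
      filter_upwards [isOpen_interior.mem_nhds hyi] with z hz
      exact (Set.indicator_of_mem hz (fun y => auxW k (u y) • G y)).symm
    · apply (continuousAt_const (y := 0)).congr
      filter_upwards [hKc.isOpen_compl.mem_nhds hy] with z hz
      exact (hout z hz).2.symm
  have hv1 : ContDiff ℝ 1 v := by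
    rw [contDiff_one_iff_hasFDerivAt]
    exact ⟨fun y => InnerProductSpace.toDual ℝ _ (V y),
      (InnerProductSpace.toDual ℝ _).continuous.comp hVc, fun y => (hgrad y).hasFDerivAt⟩
  have hw := aux_weak q hq Ω hΩ_comp u G hu M hM v hv1 hvc (hvs.trans hKi)
  have e1 : ∫ y in interior Ω, v y = ∫ y in interior Ω, auxH k (u y) :=
    setIntegral_congr_fun isOpen_interior.measurableSet fun y hy => Set.indicator_of_mem hy _
  rw [← e1, ← hw]
  refine setIntegral_congr_fun isOpen_interior.measurableSet fun y hy => ?_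
  have h3 : V y = auxW k (u y) • G y := Set.indicator_of_mem hy _
  simp only [(hgrad y).gradient, h3, inner_smul_right, real_inner_self_eq_norm_sq]
  rcases eq_or_ne (G y) 0 with h0 | h0
  · simp [h0, Real.zero_rpow (by linarith : q ≠ 0)]
  · have hp : 0 < ‖G y‖ := norm_pos_iff.2 h0
    have : ‖G y‖ ^ q = ‖G y‖ ^ (q - 2) * ‖G y‖ ^ 2 := by
      rw [← Real.rpow_natCast, ← Real.rpow_add hp]; congr 1; push_cast; ring
    rw [this]; ring

/-- For a `q`-torsion function `u` of a convex body `Ω` with bounded gradient on the interior,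
`∫_{int Ω} ‖∇u‖^q = ∫_Ω u`. -/
theorem stmt4 (n : ℕ) (hn : 2 ≤ n) (q : ℝ) (hq : 1 < q)
    (Ω : Set (EuclideanSpace ℝ (Fin n))) (hΩ_comp : IsCompact Ω) (hΩ_conv : Convex ℝ Ω)
    (hΩ_int : (interior Ω).Nonempty)
    (u : EuclideanSpace ℝ (Fin n) → ℝ)
    (G : EuclideanSpace ℝ (Fin n) → EuclideanSpace ℝ (Fin n))
    (hu : IsQTorsion q Ω u G)
    (hbdd : ∃ M : ℝ, ∀ y ∈ interior Ω, ‖G y‖ ≤ M) :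
    ∫ y in interior Ω, ‖G y‖ ^ q = ∫ y in Ω, u y := by
  obtain ⟨M, hM⟩ := hbdd
  have hfin : volume (interior Ω) ≠ ∞ :=
    ((measure_mono interior_subset).trans_lt hΩ_comp.measure_lt_top).ne
  have : IsFiniteMeasure (volume.restrict (interior Ω)) := ⟨by simpa using hfin.lt_top⟩
  have hGm : AEStronglyMeasurable G (volume.restrict (interior Ω)) :=
    (hu.grad_cont.mono interior_subset).aestronglyMeasurable isOpen_interior.measurableSet
  have hum : AEMeasurable u (volume.restrict (interior Ω)) :=
    (hu.contOn.mono interior_subset).aemeasurable isOpen_interior.measurableSet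
  obtain ⟨D, hD⟩ := hΩ_comp.exists_bound_of_continuousOn hu.contOn
  have e : ∫ y in interior Ω, u y = ∫ y in Ω, u y := by
    refine (setIntegral_eq_of_subset_of_forall_sdiff_eq_zero hΩ_comp.measurableSet
      interior_subset fun y hy => ?_).symm
    exact hu.zero_on_bdry y ⟨subset_closure hy.1, hy.2⟩
  have t1 : Tendsto (fun k => ∫ y in interior Ω, auxH k (u y)) atTop
      (𝓝 (∫ y in interior Ω, u y)) := by
    refine tendsto_integral_of_dominated_convergence (fun _ => D)
      (fun k => ((auxH_cont k).measurable.comp_aemeasurable hum).aestronglyMeasurable)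
      (integrable_const _) (fun k => ?_) ?_
    · filter_upwards [ae_restrict_mem isOpen_interior.measurableSet] with x hx
      exact (auxH_bound k _).trans (hD x (interior_subset hx))
    · filter_upwards [ae_restrict_mem isOpen_interior.measurableSet] with x hx
      exact auxH_tendsto _ (hu.pos_on_int x hx)
  have t2 : Tendsto (fun k => ∫ y in interior Ω, auxW k (u y) * ‖G y‖ ^ q) atTop
      (𝓝 (∫ y in interior Ω, ‖G y‖ ^ q)) := by
    refine tendsto_integral_of_dominated_convergence (fun _ => M ^ q)
      (fun k => ((auxW_cont k).measurable.comp_aemeasurable hum).aestronglyMeasurable.mul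
        (hGm.norm.aemeasurable.pow_const _).aestronglyMeasurable)
      (integrable_const _) (fun k => ?_) ?_
    · filter_upwards [ae_restrict_mem isOpen_interior.measurableSet] with x hx
      have hp : 0 ≤ ‖G x‖ ^ q := by positivity
      rw [Real.norm_of_nonneg (mul_nonneg (auxW_nonneg _ _) hp)]
      exact (mul_le_of_le_one_left hp (auxW_le _ _)).trans
        (Real.rpow_le_rpow (norm_nonneg _) (hM x hx) (by linarith))
    · filter_upwards [ae_restrict_mem isOpen_interior.measurableSet] with x hx
      simpa using (auxW_tendsto _ (hu.pos_on_int x hx)).mul_const (‖G x‖ ^ q)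
  rw [← e]
  exact tendsto_nhds_unique t2
    (t1.congr fun k => (aux_trunc q hq Ω hΩ_comp u G hu M hM k).symm)
end

section
/- Let n ≥ 2, q > 1, p ∈ ℝ, let Ω be a convex body in ℝⁿ containing the origin in its interior, and let u be a q-torsion function of Ω. Then the set function η ↦ Q̃_{q,n-p}(Ω,η) = ((q-1)/(n(q-1)+q)) ∫_{α*_Ω(η)} ρ_Ω(v)^p ‖∇u(ρ_Ω(v)v)‖^q dσ(v), defined on Borel subsets η of S^{n-1}, is a finite Borel measure on S^{n-1}: for every Borel η the set α*_Ω(η) is measurable with respect to the completion of σ, Q̃_{q,n-p}(Ω,∅) = 0, and Q̃_{q,n-p}(Ω,·) is countably additive on pairwise disjoint Borel sets. -/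
open MeasureTheory Metric Filter
open scoped InnerProductSpace ENNReal Topology

lemma exists_isCompact_lt_measure_image {α : Type*} [TopologicalSpace α] [T2Space α]
    [MeasurableSpace α] [BorelSpace α] (μ : Measure α) [μ.OuterRegular]
    (f : (ℕ → ℕ) → α) (hf : Continuous f) (c : ℝ≥0∞) (hc : c < μ (Set.range f)) :
    ∃ K : Set α, IsCompact K ∧ K ⊆ Set.range f ∧ c ≤ μ K := by
  classical
  have step : ∀ (A : Set (ℕ → ℕ)) (k : ℕ), ∃ m : ℕ, c < μ (f '' A) →
      c < μ (f '' (A ∩ {x | x k ≤ m})) := by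
    intro A k
    by_cases h : c < μ (f '' A)
    · have hA : f '' A = ⋃ m : ℕ, f '' (A ∩ {x | x k ≤ m}) := by
        rw [← Set.image_iUnion]
        congr 1
        ext x
        simp only [Set.mem_iUnion, Set.mem_inter_iff, Set.mem_ofPred_eq, exists_and_left]
        exact ⟨fun hx => ⟨hx, x k, le_rfl⟩, fun hx => hx.1⟩
      have hmono : Monotone (fun m : ℕ => f '' (A ∩ {x | x k ≤ m})) := by
        intro a b hab
        apply Set.image_mono
        rintro x ⟨hx, hx'⟩
        exact ⟨hx, le_trans hx' hab⟩
      rw [hA, hmono.measure_iUnion, lt_iSup_iff] at h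
      obtain ⟨m, hm⟩ := h
      exact ⟨m, fun _ => hm⟩
    · exact ⟨0, fun h' => absurd h' h⟩
  choose m hm using step
  let A : ℕ → Set (ℕ → ℕ) := fun k =>
    Nat.rec Set.univ (fun k A => A ∩ {x | x k ≤ m A k}) k
  let b : ℕ → ℕ := fun k => m (A k) k
  have hA0 : A 0 = Set.univ := rfl
  have hAs : ∀ k, A (k + 1) = A k ∩ {x | x k ≤ b k} := fun k => rfl
  have hAc : ∀ k, c < μ (f '' A k) := by
    intro k
    induction k with
    | zero => rw [hA0, Set.image_univ]; exact hc
    | succ k ih => exact hm (A k) k ih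
  have hAmem : ∀ k, ∀ x ∈ A k, ∀ i < k, x i ≤ b i := by
    intro k
    induction k with
    | zero => intro x _ i hi; omega
    | succ k ih =>
      intro x hx i hi
      rw [hAs] at hx
      rcases Nat.lt_succ_iff_lt_or_eq.1 hi with h | h
      · exact ih x hx.1 i h
      · subst h; exact hx.2
  let K : Set (ℕ → ℕ) := Set.pi Set.univ (fun i => Set.Iic (b i))
  have hK : IsCompact K := isCompact_univ_pi (fun i => (Set.finite_Iic (b i)).isCompact)
  refine ⟨f '' K, hK.image hf, Set.image_subset_range _ _, ?_⟩
  by_contra hlt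
  push Not at hlt
  obtain ⟨U, hKU, hU, hUc⟩ := Set.exists_isOpen_lt_of_lt (f '' K) c hlt
  have key : ∃ k, A k ⊆ f ⁻¹' U := by
    by_contra hno
    push Not at hno
    have : ∀ k, ∃ x, x ∈ A k ∧ x ∉ f ⁻¹' U := fun k => Set.not_subset.1 (hno k)
    choose x hxA hxU using this
    let y : ℕ → ℕ → ℕ := fun k i => min (x k i) (b i)
    have hy : ∀ k, y k ∈ K := fun k i _ => Set.mem_Iic.2 (min_le_right _ _)
    obtain ⟨z, hz, φ, hφ, hlim⟩ := hK.tendsto_subseq hy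
    have hlim' : Tendsto (x ∘ φ) atTop (𝓝 z) := by
      rw [tendsto_pi_nhds] at hlim ⊢
      intro i
      refine (hlim i).congr' ?_
      filter_upwards [eventually_gt_atTop i] with j hj
      have : i < φ j := lt_of_lt_of_le hj (hφ.id_le j)
      exact min_eq_left (hAmem _ _ (hxA (φ j)) i this)
    have hzU : f ⁻¹' U ∈ 𝓝 z := (hU.preimage hf).mem_nhds (hKU ⟨z, hz, rfl⟩)
    obtain ⟨j, hj⟩ := (hlim'.eventually hzU).exists
    exact hxU _ hj
  obtain ⟨k, hk⟩ := key
  have : μ (f '' A k) ≤ μ U := measure_mono (Set.image_subset_iff.2 hk)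
  exact absurd (lt_of_lt_of_le (hAc k) this) (not_lt.2 hUc.le)

lemma analyticSet_nullMeasurableSet {α : Type*} [TopologicalSpace α] [T2Space α]
    [MeasurableSpace α] [BorelSpace α] (μ : Measure α) [μ.OuterRegular] [IsFiniteMeasure μ]
    {S : Set α} (hS : AnalyticSet S) : NullMeasurableSet S μ := by
  rw [AnalyticSet] at hS
  rcases hS with rfl | ⟨f, hf, rfl⟩
  · exact MeasurableSet.empty.nullMeasurableSet
  rcases eq_or_ne (μ (Set.range f)) 0 with h0 | h0
  · exact NullMeasurableSet.of_null h0
  obtain ⟨c, -, hc, hlim⟩ := exists_seq_strictMono_tendsto' (pos_iff_ne_zero.2 h0)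
  choose K hK hKs hKc using
    fun k => exists_isCompact_lt_measure_image μ f hf (c k) (hc k).2
  have hT : MeasurableSet (⋃ k, K k) := MeasurableSet.iUnion fun k => (hK k).measurableSet
  have hle : μ (Set.range f) ≤ μ (⋃ k, K k) :=
    le_of_tendsto' hlim fun k => (hKc k).trans (measure_mono (Set.subset_iUnion _ _))
  have := ae_eq_of_subset_of_measure_ge (Set.iUnion_subset hKs) hle hT.nullMeasurableSet
    (measure_ne_top _ _)
  exact hT.nullMeasurableSet.congr this

/-- The point of the hyperplane `x_i = s` with remaining coordinates `w`. -/
noncomputable def faceMap {m : ℕ} (i : Fin (m + 1)) (s : ℝ) (w : Fin m → ℝ) :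
    EuclideanSpace ℝ (Fin (m + 1)) :=
  WithLp.toLp 2 (i.insertNth s w : Fin (m + 1) → ℝ)

lemma faceMap_lipschitz {m : ℕ} (i : Fin (m + 1)) (s : ℝ) :
    ∃ C, LipschitzWith C (faceMap i s) := by
  have h1 : LipschitzWith 1 (fun w : Fin m → ℝ => (i.insertNth s w : Fin (m + 1) → ℝ)) := by
    refine LipschitzWith.of_dist_le_mul fun w w' => ?_
    rw [NNReal.coe_one, one_mul, dist_pi_le_iff dist_nonneg, Fin.forall_iff_succAbove i]
    refine ⟨by simp, fun j => ?_⟩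
    simpa using dist_le_pi_dist w w' j
  exact ⟨_, (PiLp.lipschitzWith_toLp 2 (fun _ : Fin (m + 1) => ℝ)).comp h1⟩

lemma faceMap_inner {m : ℕ} (i : Fin (m + 1)) (s : ℝ) (w : Fin m → ℝ)
    (ζ : EuclideanSpace ℝ (Fin (m + 1))) :
    ⟪faceMap i s w, ζ⟫_ℝ = s * ζ i + ∑ j, w j * ζ (i.succAbove j) := by
  rw [PiLp.inner_apply, Fin.sum_univ_succAbove _ i]
  simp [faceMap, mul_comm]

lemma one_le_norm_faceMap {m : ℕ} (i : Fin (m + 1)) (s : ℝ) (hs : |s| = 1) (w : Fin m → ℝ) :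
    1 ≤ ‖faceMap i s w‖ := by
  have := PiLp.norm_apply_le (p := 2) (faceMap i s w) i
  simpa [faceMap, hs] using this

lemma normalize_lipschitz {E : Type*} [NormedAddCommGroup E] [NormedSpace ℝ E] :
    LipschitzOnWith 2 (fun x : E => ‖x‖⁻¹ • x) {x | 1 ≤ ‖x‖} := by
  refine LipschitzOnWith.of_dist_le_mul fun x hx y hy => ?_
  have hx : 1 ≤ ‖x‖ := hx
  have hy : 1 ≤ ‖y‖ := hy
  have hx0 : ‖x‖ ≠ 0 := by positivity
  have hy0 : ‖y‖ ≠ 0 := by positivity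
  rw [dist_eq_norm, dist_eq_norm]
  have e : ‖x‖⁻¹ • x - ‖y‖⁻¹ • y = ‖x‖⁻¹ • (x - y) + (‖x‖⁻¹ - ‖y‖⁻¹) • y := by module
  have h1 : ‖‖x‖⁻¹ • (x - y)‖ ≤ ‖x - y‖ := by
    rw [norm_smul, norm_inv, norm_norm]
    exact mul_le_of_le_one_left (norm_nonneg _) (inv_le_one_of_one_le₀ hx)
  have h2 : ‖(‖x‖⁻¹ - ‖y‖⁻¹) • y‖ ≤ ‖x - y‖ := by
    have : ‖x‖⁻¹ - ‖y‖⁻¹ = ‖x‖⁻¹ * (‖y‖ - ‖x‖) * ‖y‖⁻¹ := by field_simp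
    rw [norm_smul, this, norm_mul, norm_mul, norm_inv, norm_inv, norm_norm, norm_norm,
      mul_assoc, inv_mul_cancel₀ hy0, mul_one]
    calc ‖x‖⁻¹ * ‖‖y‖ - ‖x‖‖ ≤ 1 * ‖‖y‖ - ‖x‖‖ := by
          gcongr; exact inv_le_one_of_one_le₀ hx
      _ ≤ ‖y - x‖ := by rw [one_mul]; exact abs_norm_sub_norm_le _ _
      _ = ‖x - y‖ := norm_sub_rev _ _
  rw [e]
  calc _ ≤ _ := norm_add_le _ _
    _ ≤ ‖x - y‖ + ‖x - y‖ := add_le_add h1 h2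
    _ = _ := by push_cast; ring

/-- Chart of the sphere given by normalizing a face of the cube. -/
noncomputable def sphMap {m : ℕ} (i : Fin (m + 1)) (s : ℝ) (w : Fin m → ℝ) :
    EuclideanSpace ℝ (Fin (m + 1)) :=
  ‖faceMap i s w‖⁻¹ • faceMap i s w

lemma sphMap_lipschitz {m : ℕ} (i : Fin (m + 1)) (s : ℝ) (hs : |s| = 1) :
    ∃ C, LipschitzWith C (sphMap i s) := by
  obtain ⟨C, hC⟩ := faceMap_lipschitz i s
  refine ⟨2 * C, ?_⟩
  rw [← lipschitzOnWith_univ]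
  exact normalize_lipschitz.comp (lipschitzOnWith_univ.2 hC)
    (fun w _ => one_le_norm_faceMap i s hs w)

lemma sphere_cover {m : ℕ} (v : EuclideanSpace ℝ (Fin (m + 1)))
    (hv : v ∈ sphere (0 : EuclideanSpace ℝ (Fin (m + 1))) 1) :
    ∃ (i : Fin (m + 1)) (s : ({1, -1} : Finset ℝ)), ∃ w ∈ Set.Icc (-1 : Fin m → ℝ) 1,
      sphMap i s w = v := by
  obtain ⟨i, hi⟩ := Finite.exists_max (fun i => |v i|)
  have hv1 : ‖v‖ = 1 := by simpa using hv
  have hpos : 0 < |v i| := by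
    by_contra h
    have h0 : v = 0 := by
      ext j
      have := (hi j).trans (not_lt.1 h)
      simpa using abs_nonpos_iff.1 this
    rw [h0] at hv1
    simp at hv1
  have hne : v i ≠ 0 := abs_pos.1 hpos
  have hs : v i / |v i| ∈ ({1, -1} : Finset ℝ) := by
    rcases lt_or_gt_of_ne hne with h | h
    · rw [abs_of_neg h, div_neg, div_self hne]; simp
    · rw [abs_of_pos h, div_self hne]; simp
  have hface : faceMap i (v i / |v i|) (fun j => v (i.succAbove j) / |v i|)
      = |v i|⁻¹ • v := by
    ext k
    revert k
    rw [Fin.forall_iff_succAbove i]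
    constructor
    · simp [faceMap, div_eq_inv_mul]
    · intro j; simp [faceMap, div_eq_inv_mul]
  refine ⟨i, ⟨_, hs⟩, fun j => v (i.succAbove j) / |v i|, ?_, ?_⟩
  · have : ∀ j : Fin m, abs (v (i.succAbove j) / abs (v i)) ≤ 1 := by
      intro j
      rw [abs_div, abs_abs, div_le_one hpos]
      exact hi _
    exact ⟨fun j => (abs_le.1 (this j)).1, fun j => (abs_le.1 (this j)).2⟩
  · simp only [sphMap]
    rw [hface, norm_smul, hv1, norm_inv, Real.norm_eq_abs, abs_abs, mul_one, inv_inv, smul_smul,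
      mul_inv_cancel₀ hpos.ne', one_smul]

lemma hausdorff_fin {m : ℕ} : (μH[(m : ℝ)] : Measure (Fin m → ℝ)) = volume := by
  have := hausdorffMeasure_pi_real (ι := Fin m)
  simpa using this

lemma abs_of_mem_pm (s : ({1, -1} : Finset ℝ)) : |(s : ℝ)| = 1 := by
  have := s.2
  simp only [Finset.mem_insert, Finset.mem_singleton] at this
  rcases this with h | h <;> rw [h] <;> simp

lemma hausdorff_sphere_lt_top {m : ℕ} :
    μH[(m : ℝ)] (sphere (0 : EuclideanSpace ℝ (Fin (m + 1))) 1) < ⊤ := by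
  have hsub : sphere (0 : EuclideanSpace ℝ (Fin (m + 1))) 1 ⊆
      ⋃ (i : Fin (m + 1)) (s : ({1, -1} : Finset ℝ)),
        sphMap i (s : ℝ) '' Set.Icc (-1 : Fin m → ℝ) 1 := by
    intro v hv
    obtain ⟨i, s, w, hw, h⟩ := sphere_cover v hv
    simp only [Set.mem_iUnion]
    exact ⟨i, s, w, hw, h⟩
  refine (measure_mono hsub).trans_lt ?_
  refine (measure_iUnion_le _).trans_lt ?_
  rw [tsum_fintype]
  refine ENNReal.sum_lt_top.2 fun i _ => ?_
  refine (measure_iUnion_le _).trans_lt ?_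
  rw [tsum_fintype]
  refine ENNReal.sum_lt_top.2 fun s _ => ?_
  obtain ⟨C, hC⟩ := sphMap_lipschitz i s (abs_of_mem_pm s)
  refine (hC.hausdorffMeasure_image_le (Nat.cast_nonneg m) _).trans_lt ?_
  rw [hausdorff_fin]
  exact ENNReal.mul_lt_top (ENNReal.rpow_lt_top_of_nonneg (Nat.cast_nonneg m) (by simp))
    isCompact_Icc.measure_lt_top

lemma subgradient_unique {m : ℕ} (g : EuclideanSpace ℝ (Fin (m + 1)) → ℝ) (i : Fin (m + 1))
    (s : ℝ) (hs : |s| = 1) (w : Fin m → ℝ)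
    (hd : DifferentiableAt ℝ (fun w => g (faceMap i s w)) w)
    (ζ₁ ζ₂ : EuclideanSpace ℝ (Fin (m + 1)))
    (h₁ : ∀ y, ⟪y, ζ₁⟫_ℝ ≤ g y) (e₁ : ⟪faceMap i s w, ζ₁⟫_ℝ = g (faceMap i s w))
    (h₂ : ∀ y, ⟪y, ζ₂⟫_ℝ ≤ g y) (e₂ : ⟪faceMap i s w, ζ₂⟫_ℝ = g (faceMap i s w)) :
    ζ₁ = ζ₂ := by
  have key : ∀ ζ : EuclideanSpace ℝ (Fin (m + 1)), (∀ y, ⟪y, ζ⟫_ℝ ≤ g y) →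
      ⟪faceMap i s w, ζ⟫_ℝ = g (faceMap i s w) → ∀ j,
      fderiv ℝ (fun w => g (faceMap i s w)) w (Pi.single j 1) = ζ (i.succAbove j) := by
    intro ζ h e j
    let L : (Fin m → ℝ) →L[ℝ] ℝ :=
      ∑ j, ζ (i.succAbove j) • (ContinuousLinearMap.proj j : (Fin m → ℝ) →L[ℝ] ℝ)
    have hL : ∀ w, L w = ∑ j, w j * ζ (i.succAbove j) := by
      intro w
      simp [L, mul_comm]
    have hmin : IsLocalMin (fun w' => g (faceMap i s w') - (s * ζ i + L w')) w := by
      refine Filter.Eventually.of_forall fun w' => ?_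
      have a := h (faceMap i s w')
      rw [faceMap_inner] at a e
      simp only [hL]
      linarith
    have hder := (hd.hasFDerivAt).sub ((L.hasFDerivAt (x := w)).const_add (s * ζ i))
    have h0 := hmin.hasFDerivAt_eq_zero hder
    have := congrArg (fun T => T (Pi.single j 1)) h0
    simp only [_root_.sub_apply, hL, _root_.zero_apply] at this
    rw [sub_eq_zero] at this
    rw [this]
    simp [Pi.single_apply]
  have hj : ∀ j, ζ₁ (i.succAbove j) = ζ₂ (i.succAbove j) := fun j => by
    rw [← key ζ₁ h₁ e₁ j, key ζ₂ h₂ e₂ j]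
  have hs0 : s ≠ 0 := by rintro rfl; simp at hs
  have hi : ζ₁ i = ζ₂ i := by
    have := e₁.trans e₂.symm
    rw [faceMap_inner, faceMap_inner] at this
    simp only [hj] at this
    exact mul_left_cancel₀ hs0 (by linarith)
  ext k
  revert k
  rw [Fin.forall_iff_succAbove i]
  exact ⟨hi, hj⟩

section body
variable {n : ℕ} {Ω : Set (EuclideanSpace ℝ (Fin n))}

lemma body_gauge_pos (hc : IsCompact Ω) (h0 : (0 : EuclideanSpace ℝ (Fin n)) ∈ interior Ω)
    {y : EuclideanSpace ℝ (Fin n)} (hy : y ≠ 0) : 0 < gauge Ω y :=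
  (gauge_pos (absorbent_nhds_zero (mem_interior_iff_mem_nhds.1 h0))
    (NormedSpace.isVonNBounded_of_isBounded ℝ hc.isBounded)).2 hy

lemma body_mem_iff (hc : IsCompact Ω) (hconv : Convex ℝ Ω)
    (h0 : (0 : EuclideanSpace ℝ (Fin n)) ∈ interior Ω) (y : EuclideanSpace ℝ (Fin n)) :
    y ∈ Ω ↔ gauge Ω y ≤ 1 := by
  rw [gauge_le_one_iff_mem_closure hconv (mem_interior_iff_mem_nhds.1 h0),
    hc.isClosed.closure_eq]

lemma radFn_eq (hc : IsCompact Ω) (hconv : Convex ℝ Ω)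
    (h0 : (0 : EuclideanSpace ℝ (Fin n)) ∈ interior Ω) {v : EuclideanSpace ℝ (Fin n)}
    (hv : v ≠ 0) : radFn Ω v = (gauge Ω v)⁻¹ := by
  have hg := body_gauge_pos hc h0 hv
  have : {c : ℝ | 0 < c ∧ c • v ∈ Ω} = Set.Ioc 0 (gauge Ω v)⁻¹ := by
    ext c
    simp only [Set.mem_ofPred_eq, Set.mem_Ioc]
    refine and_congr_right fun hc0 => ?_
    rw [body_mem_iff hc hconv h0, gauge_smul_of_nonneg hc0.le, smul_eq_mul, ← one_div,
      le_div_iff₀ hg]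
  rw [radFn, this, csSup_Ioc (inv_pos.2 hg)]

lemma radFn_smul_mem (hc : IsCompact Ω) (hconv : Convex ℝ Ω)
    (h0 : (0 : EuclideanSpace ℝ (Fin n)) ∈ interior Ω) {v : EuclideanSpace ℝ (Fin n)}
    (hv : v ≠ 0) : radFn Ω v • v ∈ Ω := by
  have hg := body_gauge_pos hc h0 hv
  rw [radFn_eq hc hconv h0 hv, body_mem_iff hc hconv h0,
    gauge_smul_of_nonneg (inv_nonneg.2 hg.le), smul_eq_mul, inv_mul_cancel₀ hg.ne']

lemma inner_le_suppFn (hc : IsCompact Ω) {y : EuclideanSpace ℝ (Fin n)} (hy : y ∈ Ω)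
    (ξ : EuclideanSpace ℝ (Fin n)) : ⟪y, ξ⟫_ℝ ≤ suppFn Ω ξ := by
  rw [real_inner_comm]
  refine le_csSup ?_ ⟨y, hy, rfl⟩
  exact (hc.image (by fun_prop)).bddAbove

lemma inner_le_suppFn_mul (hc : IsCompact Ω) (hconv : Convex ℝ Ω)
    (h0 : (0 : EuclideanSpace ℝ (Fin n)) ∈ interior Ω) (y ξ : EuclideanSpace ℝ (Fin n)) :
    ⟪y, ξ⟫_ℝ ≤ suppFn Ω ξ * gauge Ω y := by
  rcases eq_or_ne y 0 with rfl | hy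
  · simp
  have hg := body_gauge_pos hc h0 hy
  have := inner_le_suppFn hc (radFn_smul_mem hc hconv h0 hy) ξ
  rw [radFn_eq hc hconv h0 hy, inner_smul_left] at this
  simp only [conj_trivial] at this
  rwa [inv_mul_le_iff₀ hg, mul_comm] at this

lemma suppFn_pos (hc : IsCompact Ω) (hconv : Convex ℝ Ω)
    (h0 : (0 : EuclideanSpace ℝ (Fin n)) ∈ interior Ω) {ξ : EuclideanSpace ℝ (Fin n)}
    (hξ : ξ ≠ 0) : 0 < suppFn Ω ξ := by
  have h := inner_le_suppFn_mul hc hconv h0 ξ ξ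
  have h1 : 0 < ⟪ξ, ξ⟫_ℝ := real_inner_self_pos.2 hξ
  exact pos_of_mul_pos_left (h1.trans_le h) (body_gauge_pos hc h0 hξ).le

lemma suppFn_continuous (hc : IsCompact Ω) : Continuous (suppFn Ω) :=
  IsCompact.continuous_sSup (f := fun x y => ⟪x, y⟫_ℝ) hc (by
    simp only [Function.HasUncurry.uncurry]; fun_prop)

lemma revRadGauss_analytic (hc : IsCompact Ω) (hconv : Convex ℝ Ω)
    (h0 : (0 : EuclideanSpace ℝ (Fin n)) ∈ interior Ω) {η : Set (EuclideanSpace ℝ (Fin n))}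
    (hη : MeasurableSet η) : AnalyticSet (revRadGauss Ω η) := by
  have hgc : Continuous (gauge Ω) := continuous_gauge hconv (mem_interior_iff_mem_nhds.1 h0)
  have hsc := suppFn_continuous hc
  have heq : revRadGauss Ω η = Prod.fst ''
      {z : EuclideanSpace ℝ (Fin n) × EuclideanSpace ℝ (Fin n) |
        (z.1 ∈ sphere (0 : EuclideanSpace ℝ (Fin n)) 1 ∧ z.2 ∈ η) ∧
          ⟪z.1, z.2⟫_ℝ = suppFn Ω z.2 * gauge Ω z.1} := by
    ext v
    simp only [revRadGauss, Set.mem_ofPred_eq, Set.mem_image, Prod.exists, exists_and_right,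
      exists_eq_right]
    constructor
    · rintro ⟨hv, ξ, hξ, h⟩
      have hv0 : v ≠ 0 := ne_zero_of_mem_unit_sphere ⟨v, hv⟩
      refine ⟨ξ, ⟨hv, hξ⟩, ?_⟩
      rw [radFn_eq hc hconv h0 hv0, inv_mul_eq_iff_eq_mul₀ (body_gauge_pos hc h0 hv0).ne'] at h
      rw [h, mul_comm]
    · rintro ⟨ξ, ⟨hv, hξ⟩, h⟩
      have hv0 : v ≠ 0 := ne_zero_of_mem_unit_sphere ⟨v, hv⟩
      refine ⟨hv, ξ, hξ, ?_⟩
      rw [radFn_eq hc hconv h0 hv0, inv_mul_eq_iff_eq_mul₀ (body_gauge_pos hc h0 hv0).ne', h,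
        mul_comm]
  rw [heq]
  refine AnalyticSet.image_of_continuous (MeasurableSet.analyticSet ?_) continuous_fst
  refine MeasurableSet.inter (MeasurableSet.inter ?_ ?_) ?_
  · exact measurable_fst isClosed_sphere.measurableSet
  · exact measurable_snd hη
  · exact (isClosed_eq (by fun_prop) (by fun_prop)).measurableSet

end body

/-- Directions at which the normal is not unique. -/
def badDir {n : ℕ} (Ω : Set (EuclideanSpace ℝ (Fin n))) : Set (EuclideanSpace ℝ (Fin n)) :=
  {v | v ∈ sphere (0 : EuclideanSpace ℝ (Fin n)) 1 ∧
    ∃ ξ₁ ∈ sphere (0 : EuclideanSpace ℝ (Fin n)) 1,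
    ∃ ξ₂ ∈ sphere (0 : EuclideanSpace ℝ (Fin n)) 1, ξ₁ ≠ ξ₂ ∧
      radFn Ω v * ⟪v, ξ₁⟫_ℝ = suppFn Ω ξ₁ ∧ radFn Ω v * ⟪v, ξ₂⟫_ℝ = suppFn Ω ξ₂}

lemma badDir_null {m : ℕ} {Ω : Set (EuclideanSpace ℝ (Fin (m + 1)))}
    (hc : IsCompact Ω) (hconv : Convex ℝ Ω)
    (h0 : (0 : EuclideanSpace ℝ (Fin (m + 1))) ∈ interior Ω) :
    μH[(m : ℝ)] (badDir Ω) = 0 := by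
  obtain ⟨Cg, hCg⟩ := hconv.lipschitz_gauge (mem_interior_iff_mem_nhds.1 h0)
  have hsub : badDir Ω ⊆
      ⋃ (i : Fin (m + 1)) (s : ({1, -1} : Finset ℝ)),
        sphMap i (s : ℝ) ''
          {w | ¬ DifferentiableAt ℝ (fun w => gauge Ω (faceMap i (s : ℝ) w)) w} := by
    rintro v ⟨hv, ξ₁, hξ₁, ξ₂, hξ₂, hne, h₁, h₂⟩
    obtain ⟨i, s, w, hw, h⟩ := sphere_cover v hv
    simp only [Set.mem_iUnion]
    refine ⟨i, s, w, fun hd => hne ?_, h⟩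
    have hs := abs_of_mem_pm s
    have hv0 : v ≠ 0 := ne_zero_of_mem_unit_sphere ⟨v, hv⟩
    have hgv := body_gauge_pos hc h0 hv0
    have hN : 0 < ‖faceMap i (s : ℝ) w‖ := one_pos.trans_le (one_le_norm_faceMap i s hs w)
    have hx : faceMap i (s : ℝ) w = ‖faceMap i (s : ℝ) w‖ • v := by
      rw [← h, sphMap, smul_smul, mul_inv_cancel₀ hN.ne', one_smul]
    have aux : ∀ ξ ∈ sphere (0 : EuclideanSpace ℝ (Fin (m + 1))) 1,
        radFn Ω v * ⟪v, ξ⟫_ℝ = suppFn Ω ξ →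
        0 < suppFn Ω ξ ∧ (∀ y, ⟪y, (suppFn Ω ξ)⁻¹ • ξ⟫_ℝ ≤ gauge Ω y) ∧
        ⟪faceMap i (s : ℝ) w, (suppFn Ω ξ)⁻¹ • ξ⟫_ℝ = gauge Ω (faceMap i (s : ℝ) w) := by
      intro ξ hξ hr
      have hp := suppFn_pos hc hconv h0 (ne_zero_of_mem_unit_sphere ⟨ξ, hξ⟩)
      refine ⟨hp, fun y => ?_, ?_⟩
      · rw [real_inner_smul_right, inv_mul_le_iff₀ hp]
        exact inner_le_suppFn_mul hc hconv h0 y ξ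
      · rw [radFn_eq hc hconv h0 hv0, inv_mul_eq_iff_eq_mul₀ hgv.ne'] at hr
        rw [hx, gauge_smul_of_nonneg hN.le, real_inner_smul_right, real_inner_smul_left, hr,
          smul_eq_mul]
        field_simp
    obtain ⟨p₁, a₁, b₁⟩ := aux ξ₁ hξ₁ h₁
    obtain ⟨p₂, a₂, b₂⟩ := aux ξ₂ hξ₂ h₂
    have hz := subgradient_unique (gauge Ω) i s hs w hd _ _ a₁ b₁ a₂ b₂
    have n₁ : ‖ξ₁‖ = 1 := by simpa using hξ₁
    have n₂ : ‖ξ₂‖ = 1 := by simpa using hξ₂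
    have hn := congrArg norm hz
    rw [norm_smul, norm_smul, n₁, n₂, mul_one, mul_one, Real.norm_of_nonneg (by positivity),
      Real.norm_of_nonneg (by positivity)] at hn
    rw [hn] at hz
    exact smul_right_injective _ (inv_pos.2 p₂).ne' hz
  refine measure_mono_null hsub ?_
  refine measure_iUnion_null fun i => measure_iUnion_null fun s => ?_
  obtain ⟨C, hC⟩ := sphMap_lipschitz i s (abs_of_mem_pm s)
  obtain ⟨C', hC'⟩ := faceMap_lipschitz i (s : ℝ)
  have hd := (hCg.comp hC').ae_differentiableAt (μ := (volume : Measure (Fin m → ℝ)))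
  have hnull : volume {w | ¬ DifferentiableAt ℝ (fun w => gauge Ω (faceMap i (s : ℝ) w)) w} = 0 :=
    hd
  have := hC.hausdorffMeasure_image_le (Nat.cast_nonneg m)
    {w | ¬ DifferentiableAt ℝ (fun w => gauge Ω (faceMap i (s : ℝ) w)) w}
  rw [hausdorff_fin, hnull, mul_zero] at this
  exact le_antisymm this bot_le

/-- The `p`-th dual `q`-torsional measure is a (finite) Borel measure on `S^{n-1}`:
reverse radial Gauss images of Borel sets are null-measurable with respect to `σ`,
the empty set gets measure `0`, and the set function is countably additive. -/
theorem stmt5 (n : ℕ) (hn : 2 ≤ n) (q p : ℝ) (hq : 1 < q)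
    (Ω : Set (EuclideanSpace ℝ (Fin n))) (hΩ_comp : IsCompact Ω) (hΩ_conv : Convex ℝ Ω)
    (hΩ0 : (0 : EuclideanSpace ℝ (Fin n)) ∈ interior Ω)
    (u : EuclideanSpace ℝ (Fin n) → ℝ)
    (G : EuclideanSpace ℝ (Fin n) → EuclideanSpace ℝ (Fin n))
    (hu : IsQTorsion q Ω u G) :
    (∀ η : Set (EuclideanSpace ℝ (Fin n)), MeasurableSet η →
      MeasureTheory.NullMeasurableSet (revRadGauss Ω η) (sphLeb n)) ∧
    dualTorsMeas q p Ω G (∅ : Set (EuclideanSpace ℝ (Fin n))) = 0 ∧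
    ∀ η : ℕ → Set (EuclideanSpace ℝ (Fin n)),
      (∀ i, MeasurableSet (η i)) →
      (∀ i, η i ⊆ sphere (0 : EuclideanSpace ℝ (Fin n)) 1) →
      Pairwise (Function.onFun Disjoint η) →
      HasSum (fun i => dualTorsMeas q p Ω G (η i)) (dualTorsMeas q p Ω G (⋃ i, η i)) := by
  obtain ⟨m, rfl⟩ : ∃ m, n = m + 1 := ⟨n - 1, by omega⟩
  have hsph : sphLeb (m + 1) = (μH[(m : ℝ)]).restrict
      (sphere (0 : EuclideanSpace ℝ (Fin (m + 1))) 1) := by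
    simp [sphLeb]
  have : IsFiniteMeasure (sphLeb (m + 1)) := by
    rw [hsph]
    exact ⟨by rw [Measure.restrict_apply_univ]; exact hausdorff_sphere_lt_top⟩
  have hnm : ∀ η : Set (EuclideanSpace ℝ (Fin (m + 1))), MeasurableSet η →
      NullMeasurableSet (revRadGauss Ω η) (sphLeb (m + 1)) := fun η hη =>
    analyticSet_nullMeasurableSet _ (revRadGauss_analytic hΩ_comp hΩ_conv hΩ0 hη)
  refine ⟨hnm, ?_, ?_⟩
  · simp [dualTorsMeas, revRadGauss]
  intro η hη hηs hdis
  have hU : revRadGauss Ω (⋃ i, η i) = ⋃ i, revRadGauss Ω (η i) := by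
    ext v
    simp only [revRadGauss, Set.mem_ofPred_eq, Set.mem_iUnion]
    constructor
    · rintro ⟨hv, ξ, ⟨i, hi⟩, h⟩
      exact ⟨i, hv, ξ, hi, h⟩
    · rintro ⟨i, hv, ξ, hi, h⟩
      exact ⟨hv, ξ, ⟨i, hi⟩, h⟩
  have hne : ∀ v ∈ sphere (0 : EuclideanSpace ℝ (Fin (m + 1))) 1, v ≠ 0 := fun v hv =>
    ne_zero_of_mem_unit_sphere ⟨v, hv⟩
  have hρ : ContinuousOn (radFn Ω) (sphere (0 : EuclideanSpace ℝ (Fin (m + 1))) 1) := by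
    have hgc : Continuous (gauge Ω) :=
      continuous_gauge hΩ_conv (mem_interior_iff_mem_nhds.1 hΩ0)
    refine (hgc.continuousOn.inv₀ fun v hv =>
      (body_gauge_pos hΩ_comp hΩ0 (hne v hv)).ne').congr fun v hv => ?_
    exact radFn_eq hΩ_comp hΩ_conv hΩ0 (hne v hv)
  have hcont : ContinuousOn (fun v => (radFn Ω v) ^ p * ‖G (radFn Ω v • v)‖ ^ q)
      (sphere (0 : EuclideanSpace ℝ (Fin (m + 1))) 1) := by
    refine ContinuousOn.mul ?_ ?_
    · refine hρ.rpow_const fun v hv => Or.inl ?_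
      rw [radFn_eq hΩ_comp hΩ_conv hΩ0 (hne v hv)]
      exact (inv_pos.2 (body_gauge_pos hΩ_comp hΩ0 (hne v hv))).ne'
    · refine ContinuousOn.rpow_const ?_ fun v hv => Or.inr (by linarith)
      refine (hu.grad_cont.comp (hρ.smul continuousOn_id) fun v hv => ?_).norm
      exact radFn_smul_mem hΩ_comp hΩ_conv hΩ0 (hne v hv)
  have hint := hcont.integrableOn_compact (μ := sphLeb (m + 1)) (isCompact_sphere _ _)
  have hbad : sphLeb (m + 1) (badDir Ω) = 0 := by
    rw [hsph]
    exact le_antisymm ((Measure.restrict_apply_le _ _).trans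
      (badDir_null hΩ_comp hΩ_conv hΩ0).le) bot_le
  have hae : Pairwise (Function.onFun (AEDisjoint (sphLeb (m + 1)))
      (fun i => revRadGauss Ω (η i))) := by
    intro i j hij
    refine measure_mono_null ?_ hbad
    rintro v ⟨⟨hv, ξ₁, hξ₁, h₁⟩, -, ξ₂, hξ₂, h₂⟩
    refine ⟨hv, ξ₁, hηs i hξ₁, ξ₂, hηs j hξ₂, ?_, h₁, h₂⟩
    rintro rfl
    exact Set.disjoint_left.1 (hdis hij) hξ₁ hξ₂
  have hs := hasSum_integral_iUnion_ae (fun i => hnm (η i) (hη i)) hae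
    (hint.mono_set (Set.iUnion_subset fun i v hv => hv.1))
  simp only [dualTorsMeas]
  rw [hU]
  exact hs.mul_left _
end
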